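/- For every unit vector ξ in ℝ⁷, the 6-form identity (ι_ξ ψ₀) ∧ (ι_ξ(ξ^# ∧ φ₀)) = 4 ι_ξ(e^{1234567}) holds; that is, Im Ω_ξ ∧ Re Ω_ξ equals 4 times the induced volume form of the hyperplane ξ⊥, so the (3,0)-form Ω_ξ = Re Ω_ξ + i Im Ω_ξ is nonvanishing (equivalently Ω_ξ ∧ conj(Ω_ξ) = 8i vol). -/

import Mathlib

open scoped RealInnerProductSpace

noncomputable section

/-- `V7` is ℝ⁷ with its Euclidean inner product. -/
abbrev V7 : Type := EuclideanSpace ℝ (Fin 7)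

/-- Evaluation of the wedge product `eⁱ ∧ eʲ ∧ eᵏ` of dual basis 1-forms on three vectors. -/
def w3 (i j k : Fin 7) (u v w : V7) : ℝ :=
  Matrix.det !![u i, u j, u k; v i, v j, v k; w i, w j, w k]

/-- Evaluation of the wedge product `eⁱ ∧ eʲ ∧ eᵏ ∧ eˡ` on four vectors. -/
def w4 (i j k l : Fin 7) (u v w z : V7) : ℝ :=
  Matrix.det !![u i, u j, u k, u l; v i, v j, v k, v l;
                w i, w j, w k, w l; z i, z j, z k, z l]

/-- The standard G₂ 3-form φ₀ = e¹²³+e¹⁴⁵+e¹⁶⁷+e²⁴⁶−e²⁵⁷−e³⁴⁷−e³⁵⁶ (0-indexed). -/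
def phi0 (u v w : V7) : ℝ :=
  w3 0 1 2 u v w + w3 0 3 4 u v w + w3 0 5 6 u v w + w3 1 3 5 u v w
    - w3 1 4 6 u v w - w3 2 3 6 u v w - w3 2 4 5 u v w

/-- The 4-form ψ₀ = ∗φ₀ = e⁴⁵⁶⁷+e²³⁶⁷+e²³⁴⁵+e¹³⁵⁷−e¹³⁴⁶−e¹²⁵⁶−e¹²⁴⁷ (0-indexed). -/
def psi0 (u v w z : V7) : ℝ :=
  w4 3 4 5 6 u v w z + w4 1 2 5 6 u v w z + w4 1 2 3 4 u v w z + w4 0 2 4 6 u v w z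
    - w4 0 2 3 5 u v w z - w4 0 1 4 5 u v w z - w4 0 1 3 6 u v w z

/-- The dual 1-form ξ^# = ⟨ξ,·⟩ of a vector ξ. -/
def sharp (ξ : V7) : V7 → ℝ := fun a => ⟪ξ, a⟫

/-- The standard volume form e¹∧⋯∧e⁷ evaluated on seven vectors. -/
def vol7 (x : Fin 7 → V7) : ℝ := Matrix.det (Matrix.of fun i j => x i j)

/-- Pointwise evaluation of the wedge (1-form) ∧ (3-form) on four vectors. -/
def wedge13 (f : V7 → ℝ) (C : V7 → V7 → V7 → ℝ) (a b c d : V7) : ℝ :=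
  f a * C b c d - f b * C a c d + f c * C a b d - f d * C a b c

/-- Re Ω_ξ = ι_ξ(ξ^# ∧ φ₀), the component of φ₀ tangent to the hyperplane ξ⊥. -/
def ReOmega (ξ : V7) (a b c : V7) : ℝ := wedge13 (sharp ξ) phi0 ξ a b c

/-- Im Ω_ξ = ι_ξ ψ₀. -/
def ImOmega (ξ : V7) (a b c : V7) : ℝ := psi0 ξ a b c

/-- Evaluation of the wedge of two 3-forms on six vectors, normalized by 1/(3!·3!). -/
def wedge33 (A B : V7 → V7 → V7 → ℝ) (x : Fin 6 → V7) : ℝ :=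
  (∑ σ : Equiv.Perm (Fin 6), ((Equiv.Perm.sign σ : ℤ) : ℝ) *
      (A (x (σ 0)) (x (σ 1)) (x (σ 2)) * B (x (σ 3)) (x (σ 4)) (x (σ 5)))) / 36


/-- The `6 × 6` minor of the matrix of the six vectors with the given columns. -/
def minor6 (x : Fin 6 → V7) (i j k l m n : Fin 7) : ℝ :=
  Matrix.det (Matrix.of fun p q : Fin 6 => x p (![i, j, k, l, m, n] q))

/-- A pair of permutations of three letters acting on six letters. -/
def pairPerm (τ : Equiv.Perm (Fin 3) × Equiv.Perm (Fin 3)) : Equiv.Perm (Fin 6) :=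
  (finSumFinEquiv (m := 3) (n := 3)).permCongr (Equiv.Perm.sumCongr τ.1 τ.2)

lemma sign_pairPerm (τ : Equiv.Perm (Fin 3) × Equiv.Perm (Fin 3)) :
    Equiv.Perm.sign (pairPerm τ) = Equiv.Perm.sign τ.1 * Equiv.Perm.sign τ.2 := by
  simp [pairPerm, Equiv.Perm.sign_permCongr, Equiv.Perm.sign_sumCongr]

lemma pairPerm_left (τ : Equiv.Perm (Fin 3) × Equiv.Perm (Fin 3)) (p : Fin 3) :
    pairPerm τ (Fin.castAdd 3 p) = Fin.castAdd 3 (τ.1 p) := by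
  have h := finSumFinEquiv_symm_apply_castAdd (m := 3) (n := 3) p
  rw [pairPerm, Equiv.permCongr_apply, h]
  rfl

lemma pairPerm_right (τ : Equiv.Perm (Fin 3) × Equiv.Perm (Fin 3)) (p : Fin 3) :
    pairPerm τ (Fin.natAdd 3 p) = Fin.natAdd 3 (τ.2 p) := by
  have h := finSumFinEquiv_symm_apply_natAdd (m := 3) (n := 3) p
  rw [pairPerm, Equiv.permCongr_apply, h]
  rfl

lemma w3_eq_sum (i j k : Fin 7) (y : Fin 3 → V7) :
    w3 i j k (y 0) (y 1) (y 2) = ∑ τ : Equiv.Perm (Fin 3), ((Equiv.Perm.sign τ : ℤ) : ℝ) *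
      ∏ p, y (τ p) (![i, j, k] p) := by
  have h : w3 i j k (y 0) (y 1) (y 2) =
      Matrix.det (Matrix.of fun p q : Fin 3 => y p (![i, j, k] q)) := by
    simp [w3, Matrix.det_fin_three]
  rw [h, Matrix.det_apply']
  rfl

lemma wedge33_w3 (i j k l m n : Fin 7) (x : Fin 6 → V7) :
    wedge33 (w3 i j k) (w3 l m n) x = minor6 x i j k l m n := by
  have key : ∀ σ : Equiv.Perm (Fin 6), ((Equiv.Perm.sign σ : ℤ) : ℝ) *
      (w3 i j k (x (σ 0)) (x (σ 1)) (x (σ 2)) * w3 l m n (x (σ 3)) (x (σ 4)) (x (σ 5))) =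
      ∑ τ : Equiv.Perm (Fin 3) × Equiv.Perm (Fin 3),
        ((Equiv.Perm.sign (σ * pairPerm τ) : ℤ) : ℝ) *
          ∏ p, x ((σ * pairPerm τ) p) (![i, j, k, l, m, n] p) := by
    intro σ
    have h1 := w3_eq_sum i j k (fun p => x (σ (Fin.castAdd 3 p)))
    have h2 := w3_eq_sum l m n (fun p => x (σ (Fin.natAdd 3 p)))
    have e1 : w3 i j k (x (σ 0)) (x (σ 1)) (x (σ 2)) = _ := h1
    have e2 : w3 l m n (x (σ 3)) (x (σ 4)) (x (σ 5)) = _ := h2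
    rw [e1, e2, Finset.sum_mul_sum, Fintype.sum_prod_type, Finset.mul_sum]
    refine Finset.sum_congr rfl fun τ _ => ?_
    rw [Finset.mul_sum]
    refine Finset.sum_congr rfl fun τ' _ => ?_
    have hp : ∏ p : Fin 6, x ((σ * pairPerm (τ, τ')) p) (![i, j, k, l, m, n] p) =
        (∏ p : Fin 3, x (σ (Fin.castAdd 3 (τ p))) (![i, j, k] p)) *
          ∏ p : Fin 3, x (σ (Fin.natAdd 3 (τ' p))) (![l, m, n] p) := by
      rw [Fin.prod_univ_add (a := 3) (b := 3)]
      simp only [Equiv.Perm.mul_apply, pairPerm_left, pairPerm_right]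
      congr 1
    rw [hp, Equiv.Perm.sign_mul, sign_pairPerm]
    push_cast
    ring
  unfold wedge33
  rw [Finset.sum_congr rfl fun σ _ => key σ, Finset.sum_comm]
  have key2 : ∀ τ : Equiv.Perm (Fin 3) × Equiv.Perm (Fin 3),
      ∑ σ : Equiv.Perm (Fin 6), ((Equiv.Perm.sign (σ * pairPerm τ) : ℤ) : ℝ) *
          ∏ p, x ((σ * pairPerm τ) p) (![i, j, k, l, m, n] p) = minor6 x i j k l m n := by
    intro τ
    rw [minor6, Matrix.det_apply']
    exact Equiv.sum_comp (Equiv.mulRight (pairPerm τ)) (fun σ : Equiv.Perm (Fin 6) =>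
      ((Equiv.Perm.sign σ : ℤ) : ℝ) * ∏ p, x (σ p) (![i, j, k, l, m, n] p))
  rw [Finset.sum_congr rfl fun τ _ => key2 τ]
  simp [Fintype.card_perm, Nat.factorial]

lemma wedge33_add_left (A A' B : V7 → V7 → V7 → ℝ) (x : Fin 6 → V7) :
    wedge33 (A + A') B x = wedge33 A B x + wedge33 A' B x := by
  simp only [wedge33, Pi.add_apply, ← add_div, ← Finset.sum_add_distrib]
  congr 1
  exact Finset.sum_congr rfl fun σ _ => by ring

lemma wedge33_smul_left (c : ℝ) (A B : V7 → V7 → V7 → ℝ) (x : Fin 6 → V7) :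
    wedge33 (c • A) B x = c * wedge33 A B x := by
  simp only [wedge33, Pi.smul_apply, smul_eq_mul, ← mul_div_assoc, Finset.mul_sum]
  congr 1
  exact Finset.sum_congr rfl fun σ _ => by ring

lemma wedge33_add_right (A B B' : V7 → V7 → V7 → ℝ) (x : Fin 6 → V7) :
    wedge33 A (B + B') x = wedge33 A B x + wedge33 A B' x := by
  simp only [wedge33, Pi.add_apply, ← add_div, ← Finset.sum_add_distrib]
  congr 1
  exact Finset.sum_congr rfl fun σ _ => by ring

lemma wedge33_smul_right (c : ℝ) (A B : V7 → V7 → V7 → ℝ) (x : Fin 6 → V7) :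
    wedge33 A (c • B) x = c * wedge33 A B x := by
  simp only [wedge33, Pi.smul_apply, smul_eq_mul, ← mul_div_assoc, Finset.mul_sum]
  congr 1
  exact Finset.sum_congr rfl fun σ _ => by ring

lemma w4_eq (i j k l : Fin 7) (ξ a b c : V7) :
    w4 i j k l ξ a b c = ξ i * w3 j k l a b c - ξ j * w3 i k l a b c
      + ξ k * w3 i j l a b c - ξ l * w3 i j k a b c := by
  simp [w4, w3, Matrix.det_succ_row_zero, Fin.sum_univ_succ, Fin.succAbove]
  ring

lemma ImOmega_eq (ξ : V7) : ImOmega ξ =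
    (ξ 3) • w3 4 5 6
    + (-ξ 4) • w3 3 5 6
    + (ξ 5) • w3 3 4 6
    + (-ξ 6) • w3 3 4 5
    + (ξ 1) • w3 2 5 6
    + (-ξ 2) • w3 1 5 6
    + (ξ 5) • w3 1 2 6
    + (-ξ 6) • w3 1 2 5
    + (ξ 1) • w3 2 3 4
    + (-ξ 2) • w3 1 3 4
    + (ξ 3) • w3 1 2 4
    + (-ξ 4) • w3 1 2 3
    + (ξ 0) • w3 2 4 6
    + (-ξ 2) • w3 0 4 6
    + (ξ 4) • w3 0 2 6
    + (-ξ 6) • w3 0 2 4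
    + (-ξ 0) • w3 2 3 5
    + (ξ 2) • w3 0 3 5
    + (-ξ 3) • w3 0 2 5
    + (ξ 5) • w3 0 2 3
    + (-ξ 0) • w3 1 4 5
    + (ξ 1) • w3 0 4 5
    + (-ξ 4) • w3 0 1 5
    + (ξ 5) • w3 0 1 4
    + (-ξ 0) • w3 1 3 6
    + (ξ 1) • w3 0 3 6
    + (-ξ 3) • w3 0 1 6
    + (ξ 6) • w3 0 1 3 := by
  funext a b c
  simp only [ImOmega, psi0, w4_eq, Pi.add_apply, Pi.smul_apply, smul_eq_mul]
  ring

set_option maxHeartbeats 4000000 in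
lemma ReOmega_eq (ξ : V7) : ReOmega ξ =
    (1 * (ξ 3 * ξ 3) + 1 * (ξ 4 * ξ 4) + 1 * (ξ 5 * ξ 5) + 1 * (ξ 6 * ξ 6)) • w3 0 1 2
    + ((-1) * (ξ 0 * ξ 5) + 1 * (ξ 1 * ξ 4) + (-1) * (ξ 2 * ξ 3)) • w3 0 1 3
    + (1 * (ξ 0 * ξ 6) + (-1) * (ξ 1 * ξ 3) + (-1) * (ξ 2 * ξ 4)) • w3 0 1 4
    + (1 * (ξ 0 * ξ 3) + 1 * (ξ 1 * ξ 6) + (-1) * (ξ 2 * ξ 5)) • w3 0 1 5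
    + ((-1) * (ξ 0 * ξ 4) + (-1) * (ξ 1 * ξ 5) + (-1) * (ξ 2 * ξ 6)) • w3 0 1 6
    + (1 * (ξ 0 * ξ 6) + 1 * (ξ 1 * ξ 3) + 1 * (ξ 2 * ξ 4)) • w3 0 2 3
    + (1 * (ξ 0 * ξ 5) + 1 * (ξ 1 * ξ 4) + (-1) * (ξ 2 * ξ 3)) • w3 0 2 4
    + ((-1) * (ξ 0 * ξ 4) + 1 * (ξ 1 * ξ 5) + 1 * (ξ 2 * ξ 6)) • w3 0 2 5
    + ((-1) * (ξ 0 * ξ 3) + 1 * (ξ 1 * ξ 6) + (-1) * (ξ 2 * ξ 5)) • w3 0 2 6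
    + (1 * (ξ 1 * ξ 1) + 1 * (ξ 2 * ξ 2) + 1 * (ξ 5 * ξ 5) + 1 * (ξ 6 * ξ 6)) • w3 0 3 4
    + ((-1) * (ξ 0 * ξ 1) + 1 * (ξ 3 * ξ 6) + (-1) * (ξ 4 * ξ 5)) • w3 0 3 5
    + (1 * (ξ 0 * ξ 2) + (-1) * (ξ 3 * ξ 5) + (-1) * (ξ 4 * ξ 6)) • w3 0 3 6
    + (1 * (ξ 0 * ξ 2) + 1 * (ξ 3 * ξ 5) + 1 * (ξ 4 * ξ 6)) • w3 0 4 5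
    + (1 * (ξ 0 * ξ 1) + 1 * (ξ 3 * ξ 6) + (-1) * (ξ 4 * ξ 5)) • w3 0 4 6
    + (1 * (ξ 1 * ξ 1) + 1 * (ξ 2 * ξ 2) + 1 * (ξ 3 * ξ 3) + 1 * (ξ 4 * ξ 4)) • w3 0 5 6
    + ((-1) * (ξ 0 * ξ 3) + 1 * (ξ 1 * ξ 6) + 1 * (ξ 2 * ξ 5)) • w3 1 2 3
    + ((-1) * (ξ 0 * ξ 4) + 1 * (ξ 1 * ξ 5) + (-1) * (ξ 2 * ξ 6)) • w3 1 2 4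
    + ((-1) * (ξ 0 * ξ 5) + (-1) * (ξ 1 * ξ 4) + (-1) * (ξ 2 * ξ 3)) • w3 1 2 5
    + ((-1) * (ξ 0 * ξ 6) + (-1) * (ξ 1 * ξ 3) + 1 * (ξ 2 * ξ 4)) • w3 1 2 6
    + ((-1) * (ξ 0 * ξ 1) + (-1) * (ξ 3 * ξ 6) + (-1) * (ξ 4 * ξ 5)) • w3 1 3 4
    + (1 * (ξ 0 * ξ 0) + 1 * (ξ 2 * ξ 2) + 1 * (ξ 4 * ξ 4) + 1 * (ξ 6 * ξ 6)) • w3 1 3 5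
    + (1 * (ξ 1 * ξ 2) + 1 * (ξ 3 * ξ 4) + (-1) * (ξ 5 * ξ 6)) • w3 1 3 6
    + (1 * (ξ 1 * ξ 2) + (-1) * (ξ 3 * ξ 4) + 1 * (ξ 5 * ξ 6)) • w3 1 4 5
    + ((-1) * (ξ 0 * ξ 0) + (-1) * (ξ 2 * ξ 2) + (-1) * (ξ 3 * ξ 3) + (-1) * (ξ 5 * ξ 5)) • w3 1 4 6
    + ((-1) * (ξ 0 * ξ 1) + 1 * (ξ 3 * ξ 6) + 1 * (ξ 4 * ξ 5)) • w3 1 5 6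
    + ((-1) * (ξ 0 * ξ 2) + (-1) * (ξ 3 * ξ 5) + 1 * (ξ 4 * ξ 6)) • w3 2 3 4
    + ((-1) * (ξ 1 * ξ 2) + 1 * (ξ 3 * ξ 4) + 1 * (ξ 5 * ξ 6)) • w3 2 3 5
    + ((-1) * (ξ 0 * ξ 0) + (-1) * (ξ 1 * ξ 1) + (-1) * (ξ 4 * ξ 4) + (-1) * (ξ 5 * ξ 5)) • w3 2 3 6
    + ((-1) * (ξ 0 * ξ 0) + (-1) * (ξ 1 * ξ 1) + (-1) * (ξ 3 * ξ 3) + (-1) * (ξ 6 * ξ 6)) • w3 2 4 5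
    + (1 * (ξ 1 * ξ 2) + 1 * (ξ 3 * ξ 4) + 1 * (ξ 5 * ξ 6)) • w3 2 4 6
    + ((-1) * (ξ 0 * ξ 2) + 1 * (ξ 3 * ξ 5) + (-1) * (ξ 4 * ξ 6)) • w3 2 5 6
    + ((-1) * (ξ 0 * ξ 5) + 1 * (ξ 1 * ξ 4) + 1 * (ξ 2 * ξ 3)) • w3 3 4 5
    + ((-1) * (ξ 0 * ξ 6) + 1 * (ξ 1 * ξ 3) + (-1) * (ξ 2 * ξ 4)) • w3 3 4 6
    + ((-1) * (ξ 0 * ξ 3) + (-1) * (ξ 1 * ξ 6) + (-1) * (ξ 2 * ξ 5)) • w3 3 5 6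
    + ((-1) * (ξ 0 * ξ 4) + (-1) * (ξ 1 * ξ 5) + 1 * (ξ 2 * ξ 6)) • w3 4 5 6 := by
  funext a b c
  simp only [ReOmega, wedge13, sharp, phi0, w3, Matrix.det_fin_three, Pi.add_apply,
    Pi.smul_apply, smul_eq_mul, PiLp.inner_apply, Fin.sum_univ_seven]
  simp
  ring

lemma minor6_zero (x : Fin 6 → V7) (i j k l m n : Fin 7) (p q : Fin 6) (hpq : p ≠ q)
    (h : (![i, j, k, l, m, n] : Fin 6 → Fin 7) p = ![i, j, k, l, m, n] q) :
    minor6 x i j k l m n = 0 := by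
  unfold minor6
  refine Matrix.det_zero_of_column_eq hpq fun r => ?_
  simp only [Matrix.of_apply, h]

lemma minor6_zero_0_3 (x : Fin 6 → V7) (i j k m n : Fin 7) :
    minor6 x i j k i m n = 0 :=
  minor6_zero x _ _ _ _ _ _ 0 3 (by decide) rfl

lemma minor6_zero_0_4 (x : Fin 6 → V7) (i j k l n : Fin 7) :
    minor6 x i j k l i n = 0 :=
  minor6_zero x _ _ _ _ _ _ 0 4 (by decide) rfl

lemma minor6_zero_0_5 (x : Fin 6 → V7) (i j k l m : Fin 7) :
    minor6 x i j k l m i = 0 :=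
  minor6_zero x _ _ _ _ _ _ 0 5 (by decide) rfl

lemma minor6_zero_1_3 (x : Fin 6 → V7) (i j k m n : Fin 7) :
    minor6 x i j k j m n = 0 :=
  minor6_zero x _ _ _ _ _ _ 1 3 (by decide) rfl

lemma minor6_zero_1_4 (x : Fin 6 → V7) (i j k l n : Fin 7) :
    minor6 x i j k l j n = 0 :=
  minor6_zero x _ _ _ _ _ _ 1 4 (by decide) rfl

lemma minor6_zero_1_5 (x : Fin 6 → V7) (i j k l m : Fin 7) :
    minor6 x i j k l m j = 0 :=
  minor6_zero x _ _ _ _ _ _ 1 5 (by decide) rfl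

lemma minor6_zero_2_3 (x : Fin 6 → V7) (i j k m n : Fin 7) :
    minor6 x i j k k m n = 0 :=
  minor6_zero x _ _ _ _ _ _ 2 3 (by decide) rfl

lemma minor6_zero_2_4 (x : Fin 6 → V7) (i j k l n : Fin 7) :
    minor6 x i j k l k n = 0 :=
  minor6_zero x _ _ _ _ _ _ 2 4 (by decide) rfl

lemma minor6_zero_2_5 (x : Fin 6 → V7) (i j k l m : Fin 7) :
    minor6 x i j k l m k = 0 :=
  minor6_zero x _ _ _ _ _ _ 2 5 (by decide) rfl

lemma minor6_swap (x : Fin 6 → V7) (i j k l m n i' j' k' l' m' n' : Fin 7) (p q : Fin 6)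
    (hpq : p ≠ q) (h : ∀ r, (![i, j, k, l, m, n] : Fin 6 → Fin 7) (Equiv.swap p q r) =
      ![i', j', k', l', m', n'] r) :
    minor6 x i j k l m n = - minor6 x i' j' k' l' m' n' := by
  unfold minor6
  have := Matrix.det_permute' (Equiv.swap p q)
    (Matrix.of fun p q : Fin 6 => x p (![i, j, k, l, m, n] q))
  rw [Equiv.Perm.sign_swap hpq] at this
  have e : (Matrix.of fun p q : Fin 6 => x p (![i', j', k', l', m', n'] q)) =
      (Matrix.of fun p q : Fin 6 => x p (![i, j, k, l, m, n] q)).submatrix id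
        (Equiv.swap p q) := by
    ext r s
    simp only [Matrix.of_apply, Matrix.submatrix_apply, h, id]
  rw [e, this]
  simp

lemma minor6_swap_0 (x : Fin 6 → V7) (i j k l m n : Fin 7) (_h : j < i) :
    minor6 x i j k l m n = - minor6 x j i k l m n :=
  minor6_swap x _ _ _ _ _ _ _ _ _ _ _ _ 0 1 (by decide) (by intro r; fin_cases r <;> rfl)

lemma minor6_swap_1 (x : Fin 6 → V7) (i j k l m n : Fin 7) (_h : k < j) :
    minor6 x i j k l m n = - minor6 x i k j l m n :=
  minor6_swap x _ _ _ _ _ _ _ _ _ _ _ _ 1 2 (by decide) (by intro r; fin_cases r <;> rfl)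

lemma minor6_swap_2 (x : Fin 6 → V7) (i j k l m n : Fin 7) (_h : l < k) :
    minor6 x i j k l m n = - minor6 x i j l k m n :=
  minor6_swap x _ _ _ _ _ _ _ _ _ _ _ _ 2 3 (by decide) (by intro r; fin_cases r <;> rfl)

lemma minor6_swap_3 (x : Fin 6 → V7) (i j k l m n : Fin 7) (_h : m < l) :
    minor6 x i j k l m n = - minor6 x i j k m l n :=
  minor6_swap x _ _ _ _ _ _ _ _ _ _ _ _ 3 4 (by decide) (by intro r; fin_cases r <;> rfl)

lemma minor6_swap_4 (x : Fin 6 → V7) (i j k l m n : Fin 7) (_h : n < m) :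
    minor6 x i j k l m n = - minor6 x i j k l n m :=
  minor6_swap x _ _ _ _ _ _ _ _ _ _ _ _ 4 5 (by decide) (by intro r; fin_cases r <;> rfl)

lemma vol7_cons (ξ : V7) (x : Fin 6 → V7) : vol7 (Fin.cons ξ x) =
    ξ 0 * minor6 x 1 2 3 4 5 6 - ξ 1 * minor6 x 0 2 3 4 5 6 + ξ 2 * minor6 x 0 1 3 4 5 6
    - ξ 3 * minor6 x 0 1 2 4 5 6 + ξ 4 * minor6 x 0 1 2 3 5 6 - ξ 5 * minor6 x 0 1 2 3 4 6
    + ξ 6 * minor6 x 0 1 2 3 4 5 := by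
  have h : ∀ (s i j k l m n : Fin 7), s.succAbove = ![i, j, k, l, m, n] →
      ((Matrix.of fun i j => (Fin.cons ξ x : Fin 7 → V7) i j).submatrix Fin.succ
        s.succAbove).det = minor6 x i j k l m n := by
    intro s i j k l m n hs
    rw [hs]
    rfl
  rw [vol7, Matrix.det_succ_row_zero, Fin.sum_univ_seven,
    h 0 1 2 3 4 5 6 (by decide), h 1 0 2 3 4 5 6 (by decide), h 2 0 1 3 4 5 6 (by decide),
    h 3 0 1 2 4 5 6 (by decide), h 4 0 1 2 3 5 6 (by decide), h 5 0 1 2 3 4 6 (by decide),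
    h 6 0 1 2 3 4 5 (by decide)]
  simp only [Matrix.of_apply, Fin.cons_zero]
  norm_num [Fin.val_ofNat]
  ring

lemma norm_sq_coords (ξ : V7) (hξ : ‖ξ‖ = 1) : ξ 0 ^ 2 + ξ 1 ^ 2 + ξ 2 ^ 2 + ξ 3 ^ 2 + ξ 4 ^ 2
    + ξ 5 ^ 2 + ξ 6 ^ 2 = 1 := by
  have := EuclideanSpace.real_norm_sq_eq ξ
  rw [hξ, Fin.sum_univ_seven] at this
  linarith

set_option maxHeartbeats 4000000 in
set_option maxRecDepth 20000 in
/-- For a unit vector ξ, Im Ω_ξ ∧ Re Ω_ξ = 4 ι_ξ(e¹²³⁴⁵⁶⁷): the (3,0)-form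
Ω_ξ = Re Ω_ξ + i Im Ω_ξ is nonvanishing (Ω_ξ ∧ conj Ω_ξ = 8i vol). -/
theorem ImOmega_wedge_ReOmega (ξ : V7) (hξ : ‖ξ‖ = 1) (x : Fin 6 → V7) :
    wedge33 (ImOmega ξ) (ReOmega ξ) x = 4 * vol7 (Fin.cons ξ x) := by
  have hn := norm_sq_coords ξ hξ
  rw [vol7_cons, ImOmega_eq]
  simp only [ReOmega_eq, wedge33_add_left, wedge33_smul_left, wedge33_add_right,
    wedge33_smul_right, wedge33_w3, minor6_zero_0_3, minor6_zero_0_4, minor6_zero_0_5,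
    minor6_zero_1_3, minor6_zero_1_4, minor6_zero_1_5, minor6_zero_2_3, minor6_zero_2_4, minor6_zero_2_5,
    mul_zero, add_zero, zero_add]
  simp (decide := true) only [minor6_swap_0, minor6_swap_1, minor6_swap_2, minor6_swap_3, minor6_swap_4]
  linear_combination (4 * (ξ 0 * minor6 x 1 2 3 4 5 6 - ξ 1 * minor6 x 0 2 3 4 5 6
    + ξ 2 * minor6 x 0 1 3 4 5 6 - ξ 3 * minor6 x 0 1 2 4 5 6 + ξ 4 * minor6 x 0 1 2 3 5 6
    - ξ 5 * minor6 x 0 1 2 3 4 6 + ξ 6 * minor6 x 0 1 2 3 4 5)) * hn
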